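/- arXiv:2006.03552 — 2 statements merged into one kernel-verified Lean document; each statement's English description precedes it below -/
import Mathlib

section
/- Let R be an m×m real symmetric positive definite matrix, let g : ℝⁿ → ℝⁿ, h : ℝⁿ → ℝ^{n×m}, μ : ℝⁿ → ℝᵐ, and ρ : ℝ → ℝⁿ be continuous, define f(x,u) = g(x) + h(x)u, and let V : ℝⁿ → ℝ be continuously differentiable. Let 0 ≤ τ, λ > 0, τ + λ ≤ T, and let x_λ : [0,T] → ℝⁿ be continuous, differentiable with x_λ'(t) = f(x_λ(t), μ(x_λ(t))) for t ∈ [0,τ) ∪ [τ+λ, T], and x_λ'(t) = f(x_λ(t), μ(x_λ(t)) − R⁻¹ h(x_λ(t))ᵀ ρ(t)) for t ∈ [τ, τ+λ). Define β = sup over s ∈ [τ, τ+λ] of −∇V(x_λ(s))ᵀ h(x_λ(s)) R⁻¹ h(x_λ(s))ᵀ ρ(s). Then for every t ∈ [τ+λ, T], V(x_λ(t)) − ( V(x_λ(0)) + ∫₀ᵗ ∇V(x_λ(s)) · f(x_λ(s), μ(x_λ(s))) ds ) ≤ λ β. -/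
open Matrix MeasureTheory

/-- **Theorem 1.** Switching from the equilibrium policy `μ` to the
exploratory control `μ(x) − R⁻¹ h(x)ᵀ ρ(t)` at time `τ` for a duration `λ` increases the
Lyapunov function `V`, relative to its evolution under the equilibrium vector field, by at
most `λ β`, where `β = sup_{s ∈ [τ,τ+λ]} −∇V(x_λ(s))ᵀ h R⁻¹ hᵀ ρ(s)`. -/
theorem kle3_theorem1 {n m : ℕ}
    (R : Matrix (Fin m) (Fin m) ℝ) (hR : R.PosDef)
    (g : (Fin n → ℝ) → (Fin n → ℝ))
    (h : (Fin n → ℝ) → Matrix (Fin n) (Fin m) ℝ)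
    (μ : (Fin n → ℝ) → (Fin m → ℝ))
    (ρ : ℝ → (Fin n → ℝ))
    (hg : Continuous g) (hh : Continuous h) (hμ : Continuous μ) (hρ : Continuous ρ)
    (f : (Fin n → ℝ) → (Fin m → ℝ) → (Fin n → ℝ))
    (hf : ∀ x u, f x u = g x + (h x).mulVec u)
    (V : (Fin n → ℝ) → ℝ) (hV : ContDiff ℝ 1 V)
    (gradV : (Fin n → ℝ) → (Fin n → ℝ))
    (hgradV : ∀ x v, fderiv ℝ V x v = gradV x ⬝ᵥ v)
    (τ lam T : ℝ) (hτ : 0 ≤ τ) (hlam : 0 < lam) (hT : τ + lam ≤ T)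
    (x : ℝ → (Fin n → ℝ))
    (hxc : ContinuousOn x (Set.Icc 0 T))
    (hx1 : ∀ t ∈ Set.Ico 0 τ ∪ Set.Icc (τ + lam) T,
      HasDerivWithinAt x (f (x t) (μ (x t))) (Set.Ico 0 τ ∪ Set.Icc (τ + lam) T) t)
    (hx2 : ∀ t ∈ Set.Ico τ (τ + lam),
      HasDerivWithinAt x (f (x t) (μ (x t) - R⁻¹.mulVec ((h (x t))ᵀ.mulVec (ρ t))))
        (Set.Ico τ (τ + lam)) t)
    (β : ℝ)
    (hβ : β = sSup ((fun s =>
      -(gradV (x s) ⬝ᵥ (h (x s)).mulVec (R⁻¹.mulVec ((h (x s))ᵀ.mulVec (ρ s))))) ''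
        Set.Icc τ (τ + lam))) :
    ∀ t ∈ Set.Icc (τ + lam) T,
      V (x t) - (V (x 0) + ∫ s in (0:ℝ)..t, gradV (x s) ⬝ᵥ f (x s) (μ (x s))) ≤ lam * β := by
  have hgc : Continuous gradV := by
    refine continuous_pi fun i => ?_
    have h1 : (fun y => gradV y i) = fun y => fderiv ℝ V y (Pi.single i 1) := by
      funext y
      rw [hgradV, dotProduct_single_one]
    rw [h1]
    exact (hV.continuous_fderiv (by norm_num)).clm_apply continuous_const
  intro t ht
  obtain ⟨ht1, ht2⟩ := ht
  set A : ℝ → ℝ := fun s => gradV (x s) ⬝ᵥ f (x s) (μ (x s)) with hA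
  set B : ℝ → ℝ := fun s =>
      -(gradV (x s) ⬝ᵥ (h (x s)).mulVec (R⁻¹.mulVec ((h (x s))ᵀ.mulVec (ρ s)))) with hB
  have hAc : ContinuousOn A (Set.Icc 0 T) := by
    have : Continuous fun y => gradV y ⬝ᵥ f y (μ y) := by
      simp only [hf]
      exact hgc.dotProduct (hg.add (hh.matrix_mulVec hμ))
    exact this.comp_continuousOn hxc
  have hBc : ContinuousOn B (Set.Icc 0 T) := by
    have : Continuous fun p : (Fin n → ℝ) × (Fin n → ℝ) =>
        -(gradV p.1 ⬝ᵥ (h p.1).mulVec (R⁻¹.mulVec ((h p.1)ᵀ.mulVec p.2))) := by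
      have h1 : Continuous fun p : (Fin n → ℝ) × (Fin n → ℝ) => h p.1 := hh.comp continuous_fst
      exact ((hgc.comp continuous_fst).dotProduct (h1.matrix_mulVec
        (continuous_const.matrix_mulVec (h1.matrix_transpose.matrix_mulVec continuous_snd)))).neg
    exact this.comp_continuousOn (hxc.prodMk hρ.continuousOn)
  have hVx : ContinuousOn (fun s => V (x s)) (Set.Icc 0 T) := hV.continuous.comp_continuousOn hxc
  have key : ∀ (a b : ℝ) (D : ℝ → ℝ), 0 ≤ a → a ≤ b → b ≤ T → ContinuousOn D (Set.Icc 0 T) →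
      (∀ s ∈ Set.Ioo a b, HasDerivAt (fun s => V (x s)) (D s) s) →
      ∫ s in a..b, D s = V (x b) - V (x a) := by
    intro a b D ha hab hb hD hd
    have hsub : Set.Icc a b ⊆ Set.Icc 0 T := Set.Icc_subset_Icc ha hb
    exact intervalIntegral.integral_eq_sub_of_hasDerivAt_of_le hab (hVx.mono hsub) hd
      ((hD.mono hsub).intervalIntegrable_of_Icc hab)
  have chain : ∀ s v, HasDerivAt x v s → HasDerivAt (fun s => V (x s)) (gradV (x s) ⬝ᵥ v) s := by
    intro s v hv
    rw [← hgradV]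
    exact ((hV.differentiable (by norm_num) (x s)).hasFDerivAt).comp_hasDerivAt s hv
  have k1 := key 0 τ A le_rfl hτ (by linarith) hAc (fun s hs => chain s _
    ((hx1 s (Or.inl ⟨hs.1.le, hs.2⟩)).hasDerivAt
      (Filter.mem_of_superset (Ioo_mem_nhds hs.1 hs.2)
        (fun y hy => Or.inl ⟨hy.1.le, hy.2⟩))))
  have k3 := key (τ + lam) t A (by linarith) ht1 ht2 hAc (fun s hs => chain s _
    ((hx1 s (Or.inr ⟨hs.1.le, hs.2.le.trans ht2⟩)).hasDerivAt
      (Filter.mem_of_superset (Ioo_mem_nhds hs.1 hs.2)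
        (fun y hy => Or.inr ⟨hy.1.le, hy.2.le.trans ht2⟩))))
  have k2 := key τ (τ + lam) (fun s => A s + B s) hτ (by linarith) hT (hAc.add hBc)
    (fun s hs => by
      have h1 := chain s _ ((hx2 s ⟨hs.1.le, hs.2⟩).hasDerivAt
        (Filter.mem_of_superset (Ioo_mem_nhds hs.1 hs.2) (fun y hy => ⟨hy.1.le, hy.2⟩)))
      convert h1 using 1
      simp only [hA, hB, hf, Matrix.mulVec_sub, dotProduct_add, dotProduct_sub]
      ring)
  have ii : ∀ (D : ℝ → ℝ) (a b : ℝ), ContinuousOn D (Set.Icc 0 T) → 0 ≤ a → a ≤ b → b ≤ T →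
      IntervalIntegrable D volume a b := fun D a b hD ha hab hb =>
    (hD.mono (Set.Icc_subset_Icc ha hb)).intervalIntegrable_of_Icc hab
  have i1 := ii A 0 τ hAc le_rfl hτ (by linarith)
  have i2 := ii A τ (τ + lam) hAc hτ (by linarith) hT
  have i3 := ii A (τ + lam) t hAc (by linarith) ht1 ht2
  have iB := ii B τ (τ + lam) hBc hτ (by linarith) hT
  rw [intervalIntegral.integral_add i2 iB] at k2
  have s1 := intervalIntegral.integral_add_adjacent_intervals i1 i2
  have s2 := intervalIntegral.integral_add_adjacent_intervals (i1.trans i2) i3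
  have bdd : BddAbove (B '' Set.Icc τ (τ + lam)) :=
    (isCompact_Icc.image_of_continuousOn (hBc.mono (Set.Icc_subset_Icc hτ hT))).bddAbove
  have hle : ∫ s in τ..(τ + lam), B s ≤ ∫ s in τ..(τ + lam), β :=
    intervalIntegral.integral_mono_on (by linarith) iB intervalIntegrable_const
      (fun s hs => hβ ▸ le_csSup bdd ⟨s, hs, rfl⟩)
  rw [intervalIntegral.integral_const, smul_eq_mul, add_sub_cancel_left] at hle
  linarith
end

section
/- Let R be an m×m real symmetric positive definite matrix, let g : ℝⁿ → ℝⁿ, h : ℝⁿ → ℝ^{n×m}, μ : ℝⁿ → ℝᵐ, and ρ : ℝ → ℝⁿ be continuous, define f(x,u) = g(x) + h(x)u, and let V : ℝⁿ → ℝ be continuously differentiable. Let 0 ≤ τ, λ > 0, τ + λ ≤ t, and let x_λ : [0,t] → ℝⁿ be continuous, differentiable with x_λ'(s) = f(x_λ(s), μ(x_λ(s))) for s ∈ [0,τ) ∪ [τ+λ, t], and x_λ'(s) = f(x_λ(s), μ(x_λ(s)) − R⁻¹ h(x_λ(s))ᵀ ρ(s)) for s ∈ [τ, τ+λ). Suppose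 there exist γ > 0 and β ∈ ℝ such that ∇V(x_λ(s)) · f(x_λ(s), μ(x_λ(s))) ≤ −γ for all s ∈ [0,t] and −∇V(x_λ(s))ᵀ h(x_λ(s)) R⁻¹ h(x_λ(s))ᵀ ρ(s) ≤ β for all s ∈ [τ, τ+λ]. Then V(x_λ(t)) ≤ V(x_λ(0)) − γ t + β λ. -/
open Matrix MeasureTheory

theorem aux_right_deriv_bound (F F' : ℝ → ℝ) (a b K : ℝ) (hab : a ≤ b)
    (hc : ContinuousOn F (Set.Icc a b))
    (hd : ∀ s ∈ Set.Ico a b, HasDerivWithinAt F (F' s) (Set.Ici s) s)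
    (hK : ∀ s ∈ Set.Ico a b, F' s ≤ K) : F b ≤ F a + K * (b - a) := by
  have hB : ∀ s : ℝ, HasDerivAt (fun s => F a + K * (s - a)) K s := by
    intro s
    simpa using (((hasDerivAt_id s).sub_const a).const_mul K).const_add (F a)
  exact image_le_of_deriv_right_le_deriv_boundary (B := fun s => F a + K * (s - a))
    (B' := fun _ => K) hc hd (by simp)
    (fun s _ => (hB s).continuousAt.continuousWithinAt)
    (fun s _ => (hB s).hasDerivWithinAt) hK ⟨hab, le_refl b⟩

/-- **key inequality of Theorem 2.** Along a trajectory that follows the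
equilibrium policy `μ` except on a switching interval `[τ, τ+λ)` where the exploratory
control `μ(x) − R⁻¹ h(x)ᵀ ρ(s)` is applied, if the Lyapunov derivative along the
equilibrium policy is bounded above by `−γ < 0` on `[0,t]` and the switching term is
bounded above by `β` on `[τ, τ+λ]`, then `V(x_λ(t)) ≤ V(x_λ(0)) − γ t + β λ`. -/
theorem kle3_theorem2_inequality {n m : ℕ}
    (R : Matrix (Fin m) (Fin m) ℝ) (hR : R.PosDef)
    (g : (Fin n → ℝ) → (Fin n → ℝ))
    (h : (Fin n → ℝ) → Matrix (Fin n) (Fin m) ℝ)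
    (μ : (Fin n → ℝ) → (Fin m → ℝ))
    (ρ : ℝ → (Fin n → ℝ))
    (hg : Continuous g) (hh : Continuous h) (hμ : Continuous μ) (hρ : Continuous ρ)
    (f : (Fin n → ℝ) → (Fin m → ℝ) → (Fin n → ℝ))
    (hf : ∀ x u, f x u = g x + (h x).mulVec u)
    (V : (Fin n → ℝ) → ℝ) (hV : ContDiff ℝ 1 V)
    (gradV : (Fin n → ℝ) → (Fin n → ℝ))
    (hgradV : ∀ x v, fderiv ℝ V x v = gradV x ⬝ᵥ v)
    (τ lam t : ℝ) (hτ : 0 ≤ τ) (hlam : 0 < lam) (ht : τ + lam ≤ t)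
    (x : ℝ → (Fin n → ℝ))
    (hxc : ContinuousOn x (Set.Icc 0 t))
    (hx1 : ∀ s ∈ Set.Ico 0 τ ∪ Set.Icc (τ + lam) t,
      HasDerivWithinAt x (f (x s) (μ (x s))) (Set.Ico 0 τ ∪ Set.Icc (τ + lam) t) s)
    (hx2 : ∀ s ∈ Set.Ico τ (τ + lam),
      HasDerivWithinAt x (f (x s) (μ (x s) - R⁻¹.mulVec ((h (x s))ᵀ.mulVec (ρ s))))
        (Set.Ico τ (τ + lam)) s)
    (γ β : ℝ) (hγ : 0 < γ)
    (hdecr : ∀ s ∈ Set.Icc 0 t, gradV (x s) ⬝ᵥ f (x s) (μ (x s)) ≤ -γ)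
    (hswitch : ∀ s ∈ Set.Icc τ (τ + lam),
      -(gradV (x s) ⬝ᵥ (h (x s)).mulVec (R⁻¹.mulVec ((h (x s))ᵀ.mulVec (ρ s)))) ≤ β) :
    V (x t) ≤ V (x 0) - γ * t + β * lam := by
  have hVd : ∀ y, HasFDerivAt V (fderiv ℝ V y) y := fun y =>
    ((hV.differentiable (by norm_num)) y).hasFDerivAt
  have hVx : ContinuousOn (fun s => V (x s)) (Set.Icc 0 t) :=
    hV.continuous.comp_continuousOn hxc
  have key : ∀ (s b : ℝ) (S : Set ℝ) (v : Fin n → ℝ), s < b → Set.Ico s b ⊆ S →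
      HasDerivWithinAt x v S s →
      HasDerivWithinAt (fun s => V (x s)) (gradV (x s) ⬝ᵥ v) (Set.Ici s) s := by
    intro s b S v hsb hS hx
    have h1 : HasDerivWithinAt x v (Set.Ici s) s :=
      hx.mono_of_mem_nhdsWithin (Filter.mem_of_superset (Ico_mem_nhdsGE hsb) hS)
    have h2 := (hVd (x s)).comp_hasDerivWithinAt s h1
    rw [hgradV] at h2
    exact h2
  have e1 := aux_right_deriv_bound (fun s => V (x s))
    (fun s => gradV (x s) ⬝ᵥ f (x s) (μ (x s))) 0 τ (-γ) hτ
    (hVx.mono (Set.Icc_subset_Icc le_rfl (by linarith)))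
    (fun s hs => key s τ (Set.Ico 0 τ ∪ Set.Icc (τ + lam) t) _ hs.2
      (fun r hr => Or.inl ⟨hs.1.trans hr.1, hr.2⟩) (hx1 s (Or.inl hs)))
    (fun s hs => hdecr s ⟨hs.1, by linarith [hs.2]⟩)
  have e2 := aux_right_deriv_bound (fun s => V (x s))
    (fun s => gradV (x s) ⬝ᵥ f (x s) (μ (x s) - R⁻¹.mulVec ((h (x s))ᵀ.mulVec (ρ s))))
    τ (τ + lam) (-γ + β) (by linarith)
    (hVx.mono (Set.Icc_subset_Icc hτ ht))
    (fun s hs => key s (τ + lam) (Set.Ico τ (τ + lam)) _ hs.2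
      (fun r hr => ⟨hs.1.trans hr.1, hr.2⟩) (hx2 s hs))
    (fun s hs => by
      have a1 := hdecr s ⟨hτ.trans hs.1, by linarith [hs.2]⟩
      have a2 := hswitch s ⟨hs.1, hs.2.le⟩
      simp only [hf, Matrix.mulVec_sub, dotProduct_add, dotProduct_sub] at a1 ⊢
      linarith)
  have e3 := aux_right_deriv_bound (fun s => V (x s))
    (fun s => gradV (x s) ⬝ᵥ f (x s) (μ (x s))) (τ + lam) t (-γ) ht
    (hVx.mono (Set.Icc_subset_Icc (by linarith) le_rfl))
    (fun s hs => key s t (Set.Ico 0 τ ∪ Set.Icc (τ + lam) t) _ hs.2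
      (fun r hr => Or.inr ⟨hs.1.trans hr.1, hr.2.le⟩) (hx1 s (Or.inr ⟨hs.1, hs.2.le⟩)))
    (fun s hs => hdecr s ⟨by linarith [hs.1], hs.2.le⟩)
  nlinarith [e1, e2, e3]
end
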